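/- For every subset S ⊆ V there exists an r-absorbing subset A ⊆ V such that S ⊆ A and λ^A(i) > 0 for every i ∈ A∖S. -/

import Mathlib

open Finset

section ZRP

variable {V : Type*} [Fintype V] [DecidableEq V]

/-- Irreducibility of a set of transition rates. -/
def IrreducibleRates (r : V → V → ℝ) : Prop :=
  ∀ i j : V, i ≠ j → ∃ (m : ℕ) (k : ℕ → V), k 0 = i ∧ k m = j ∧ ∀ l < m, 0 < r (k l) (k (l + 1))

/-- `ind A j` plays the role of the vector `1^A_j`: it equals the indicator of `{j}` on `A`
and is harmonic (for the generator of `r`) at every point outside `A`. -/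
def IsHarmFamily (r : V → V → ℝ) (ind : Finset V → V → V → ℝ) : Prop :=
  ∀ (A : Finset V), ∀ j ∈ A,
    (∀ i ∈ A, ind A j i = if i = j then (1 : ℝ) else 0) ∧
    (∀ k, k ∉ A → ∑ l, r k l * (ind A j l - ind A j k) = 0)

/-- The trace rates `r^A(i,j) = r(i,j) + ∑_{k∉A} r(i,k)·1^A_j(k)` (for `i ≠ j`). -/
noncomputable def traceRate (r : V → V → ℝ) (ind : Finset V → V → V → ℝ)
    (A : Finset V) (i j : V) : ℝ :=
  if i = j then 0 else r i j + ∑ k ∈ Aᶜ, r i k * ind A j k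

/-- `λ^A(i) = ∑_{j∈A} (r^A(j,i) − r^A(i,j))`. -/
noncomputable def lamA (r : V → V → ℝ) (ind : Finset V → V → V → ℝ)
    (A : Finset V) (i : V) : ℝ :=
  ∑ j ∈ A, (traceRate r ind A j i - traceRate r ind A i j)

/-- `A` is `r`-absorbing if `A = V` or `λ^{A∪{j}}(j) ≤ 0` for every `j ∉ A`. -/
def IsAbsorbing (r : V → V → ℝ) (ind : Finset V → V → V → ℝ) (A : Finset V) : Prop :=
  A = Finset.univ ∨ ∀ j ∉ A, lamA r ind (insert j A) j ≤ 0

/-- The support `𝒮(u) = {i : u i > 0}`. -/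
noncomputable def suppF (u : V → ℝ) : Finset V :=
  open scoped Classical in Finset.univ.filter (fun i => 0 < u i)

/-- `𝒜(S)`: the intersection of all `r`-absorbing subsets of `V` containing `S`. -/
noncomputable def minAbs (r : V → V → ℝ) (ind : Finset V → V → V → ℝ) (S : Finset V) :
    Finset V :=
  open scoped Classical in
  Finset.univ.filter (fun i => ∀ A : Finset V, IsAbsorbing r ind A → S ⊆ A → i ∈ A)

/-- The vector `v_i = ∑_k r(i,k)(1_{k} − 1_{i})`. -/
noncomputable def vvec (r : V → V → ℝ) (i : V) : V → ℝ :=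
  fun l => ∑ k, r i k * ((if l = k then (1 : ℝ) else 0) - (if l = i then (1 : ℝ) else 0))

/-- The vector `λ(j) = ∑_i (r(i,j) − r(j,i))`. -/
noncomputable def lamV (r : V → V → ℝ) : V → ℝ := fun j => ∑ i, (r i j - r j i)

/-- Membership in `D_B`: `f` is `C¹` on an open set containing the simplex and
`⟨∇f(u), v_i⟩ = 0` whenever `u ∈ Σ`, `u i = 0`, for every `i ∈ B`. -/
def MemD (r : V → V → ℝ) (B : Finset V) (f : (V → ℝ) → ℝ) : Prop :=
  (∃ U : Set (V → ℝ), IsOpen U ∧ stdSimplex ℝ V ⊆ U ∧ ContDiffOn ℝ 1 f U) ∧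
  ∀ i ∈ B, ∀ u ∈ stdSimplex ℝ V, u i = 0 → fderiv ℝ f u (vvec r i) = 0

/-- Condition (A). -/
def CondA (r : V → V → ℝ) (ζ : ℝ → V → ℝ) : Prop :=
  ∀ f : (V → ℝ) → ℝ, MemD r Finset.univ f → ∀ t : ℝ, 0 ≤ t →
    f (ζ t) = f (ζ 0) + ∫ s in (0:ℝ)..t, fderiv ℝ f (ζ s) (lamV r)

/-- A continuous path in the simplex (for nonnegative times). -/
def IsPath (ζ : ℝ → V → ℝ) : Prop :=
  ContinuousOn ζ (Set.Ici 0) ∧ ∀ t : ℝ, 0 ≤ t → ζ t ∈ stdSimplex ℝ V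

/-- `Σ_abs`: the configurations whose support is `r`-absorbing. -/
def SigmaAbs (r : V → V → ℝ) (ind : Finset V → V → V → ℝ) : Set (V → ℝ) :=
  {u | u ∈ stdSimplex ℝ V ∧ IsAbsorbing r ind (suppF u)}

/-- Condition (B): `inf{t ≥ 0 : ζ_t ∈ Σ_abs} = 0`. -/
def CondB (r : V → V → ℝ) (ind : Finset V → V → V → ℝ) (ζ : ℝ → V → ℝ) : Prop :=
  ∀ ε : ℝ, 0 < ε → ∃ t : ℝ, 0 ≤ t ∧ t < ε ∧ ζ t ∈ SigmaAbs r ind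

end ZRP

section HarmonicVectors

variable {V : Type*} [Fintype V]

/-- The generator of the rates `r`, acting on vectors. -/
noncomputable def generator (r : V → V → ℝ) : (V → ℝ) →ₗ[ℝ] (V → ℝ) where
  toFun w i := ∑ l, r i l * (w l - w i)
  map_add' w w' := by
    ext i
    simp only [Pi.add_apply, ← Finset.sum_add_distrib]
    exact Finset.sum_congr rfl fun _ _ => by ring
  map_smul' c w := by
    ext i
    simp only [Pi.smul_apply, smul_eq_mul, RingHom.id_apply, Finset.mul_sum]
    exact Finset.sum_congr rfl fun _ _ => by ring

theorem generator_apply (r : V → V → ℝ) (w : V → ℝ) (i : V) :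
    generator r w i = ∑ l, r i l * (w l - w i) := rfl

theorem generator_const (r : V → V → ℝ) (c : ℝ) : generator r (fun _ => c) = 0 := by
  ext i
  simp [generator_apply]

/-- Summing the generator against the counting measure gives the pairing with `lamV`. -/
theorem sum_generator (r : V → V → ℝ) (w : V → ℝ) :
    ∑ i, generator r w i = ∑ k, lamV r k * w k := by
  simp only [generator_apply, lamV, mul_sub, sub_mul, Finset.sum_sub_distrib, Finset.sum_mul]
  congr 1
  exact Finset.sum_comm

/-- The maximum principle. -/
theorem nonpos_of_generator_eq_zero {r : V → V → ℝ} (hr_nonneg : ∀ i j, 0 ≤ r i j)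
    (hr_irr : IrreducibleRates r) {A : Finset V} (hA : A.Nonempty) {w : V → ℝ}
    (hw : ∀ i ∈ A, w i ≤ 0) (hharm : ∀ k ∉ A, generator r w k = 0) (x : V) : w x ≤ 0 := by
  obtain ⟨a, ha⟩ := hA
  obtain ⟨y, -, hy⟩ := Finset.exists_max_image Finset.univ w ⟨x, Finset.mem_univ x⟩
  refine (hy x (Finset.mem_univ x)).trans ?_
  by_contra! hpos
  have hya : y ≠ a := fun h => (hw a ha).not_gt (h ▸ hpos)
  obtain ⟨m, k, hk0, hkm, hk⟩ := hr_irr y a hya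
  have hmax : ∀ l ≤ m, w (k l) = w y := by
    intro l
    induction l with
    | zero => intro _; rw [hk0]
    | succ l ih =>
      intro hl
      have hwl : w (k l) = w y := ih (by omega)
      have hout : k l ∉ A := fun h => (hw _ h).not_gt (hwl ▸ hpos)
      have hsum := hharm _ hout
      rw [generator_apply, Finset.sum_eq_zero_iff_of_nonpos] at hsum
      · have := hsum (k (l + 1)) (Finset.mem_univ _)
        rcases mul_eq_zero.mp this with h | h
        · exact absurd h (hk l (by omega)).ne'
        · linarith
      · intro z _
        refine mul_nonpos_of_nonneg_of_nonpos (hr_nonneg _ _) ?_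
        have := hy z (Finset.mem_univ z)
        linarith
  have := hmax m le_rfl
  rw [hkm] at this
  exact (hw a ha).not_gt (this ▸ hpos)

theorem le_of_generator_eq_zero {r : V → V → ℝ} (hr_nonneg : ∀ i j, 0 ≤ r i j)
    (hr_irr : IrreducibleRates r) {A : Finset V} (hA : A.Nonempty) {w w' : V → ℝ}
    (hle : ∀ i ∈ A, w i ≤ w' i) (hw : ∀ k ∉ A, generator r w k = 0)
    (hw' : ∀ k ∉ A, generator r w' k = 0) : w ≤ w' := by
  intro x
  refine sub_nonpos.mp (nonpos_of_generator_eq_zero (w := w - w') hr_nonneg hr_irr hA ?_ ?_ x)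
  · intro i hi
    simpa using hle i hi
  · intro k hk
    simp [hw k hk, hw' k hk]

/-- A vector is determined by its values on a nonempty set off which it is harmonic. -/
theorem eq_of_generator_eq_zero {r : V → V → ℝ} (hr_nonneg : ∀ i j, 0 ≤ r i j)
    (hr_irr : IrreducibleRates r) {A : Finset V} (hA : A.Nonempty) {w w' : V → ℝ}
    (heq : ∀ i ∈ A, w i = w' i) (hw : ∀ k ∉ A, generator r w k = 0)
    (hw' : ∀ k ∉ A, generator r w' k = 0) : w = w' :=
  le_antisymm
    (le_of_generator_eq_zero hr_nonneg hr_irr hA (fun i hi => (heq i hi).le) hw hw')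
    (le_of_generator_eq_zero hr_nonneg hr_irr hA (fun i hi => (heq i hi).ge) hw' hw)

end HarmonicVectors

namespace IsHarmFamily

variable {V : Type*} [Fintype V] [DecidableEq V] {r : V → V → ℝ} {ind : Finset V → V → V → ℝ}

theorem apply_of_mem (hind : IsHarmFamily r ind) {A : Finset V} {i j : V} (hj : j ∈ A)
    (hi : i ∈ A) : ind A j i = if i = j then (1 : ℝ) else 0 :=
  (hind A j hj).1 i hi

theorem generator_eq_zero (hind : IsHarmFamily r ind) {A : Finset V} {j k : V} (hj : j ∈ A)
    (hk : k ∉ A) : generator r (ind A j) k = 0 :=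
  (hind A j hj).2 k hk

theorem nonneg (hind : IsHarmFamily r ind) (hr_nonneg : ∀ i j, 0 ≤ r i j)
    (hr_irr : IrreducibleRates r) {A : Finset V} {j : V} (hj : j ∈ A) (x : V) :
    0 ≤ ind A j x := by
  refine le_of_generator_eq_zero (w := fun _ => 0) hr_nonneg hr_irr ⟨j, hj⟩ ?_ ?_
    (fun k hk => hind.generator_eq_zero hj hk) x
  · intro i hi
    rw [hind.apply_of_mem hj hi]
    split_ifs <;> norm_num
  · simp [generator_const]

theorem le_one (hind : IsHarmFamily r ind) (hr_nonneg : ∀ i j, 0 ≤ r i j)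
    (hr_irr : IrreducibleRates r) {A : Finset V} {j : V} (hj : j ∈ A) (x : V) :
    ind A j x ≤ 1 := by
  refine le_of_generator_eq_zero (w' := fun _ => 1) hr_nonneg hr_irr ⟨j, hj⟩ ?_
    (fun k hk => hind.generator_eq_zero hj hk) ?_ x
  · intro i hi
    rw [hind.apply_of_mem hj hi]
    split_ifs <;> norm_num
  · simp [generator_const]

theorem sum_eq_one (hind : IsHarmFamily r ind) (hr_nonneg : ∀ i j, 0 ≤ r i j)
    (hr_irr : IrreducibleRates r) {A : Finset V} (hA : A.Nonempty) (x : V) :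
    ∑ j ∈ A, ind A j x = 1 := by
  have h : ∑ j ∈ A, ind A j = fun _ => (1 : ℝ) := by
    refine eq_of_generator_eq_zero hr_nonneg hr_irr hA ?_ ?_ ?_
    · intro i hi
      rw [Finset.sum_apply, Finset.sum_congr rfl fun j hj => hind.apply_of_mem hj hi]
      simp [hi]
    · intro k hk
      rw [map_sum, Finset.sum_apply]
      exact Finset.sum_eq_zero fun j hj => hind.generator_eq_zero hj hk
    · simp [generator_const]
  simpa using congrFun h x

/-- Decomposition of `1^A_i` over the enlarged set `A ∪ {b}`. -/
theorem eq_add_smul_insert (hind : IsHarmFamily r ind) (hr_nonneg : ∀ i j, 0 ≤ r i j)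
    (hr_irr : IrreducibleRates r) {A : Finset V} {i b : V} (hi : i ∈ A) (hb : b ∉ A) :
    ind A i = ind (insert b A) i + ind A i b • ind (insert b A) b := by
  have hiB : i ∈ insert b A := Finset.mem_insert_of_mem hi
  have hbB : b ∈ insert b A := Finset.mem_insert_self b A
  have hbi : b ≠ i := fun h => hb (h ▸ hi)
  refine eq_of_generator_eq_zero hr_nonneg hr_irr ⟨b, hbB⟩ ?_ ?_ ?_
  · intro x hx
    rw [Pi.add_apply, Pi.smul_apply, hind.apply_of_mem hiB hx, hind.apply_of_mem hbB hx]
    rcases Finset.mem_insert.mp hx with rfl | hxA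
    · simp [hbi]
    · have hxb : x ≠ b := fun h => hb (h ▸ hxA)
      simp [hind.apply_of_mem hi hxA, hxb]
  · exact fun k hk => hind.generator_eq_zero hi fun h => hk (Finset.mem_insert_of_mem h)
  · intro k hk
    simp [hind.generator_eq_zero hiB hk, hind.generator_eq_zero hbB hk]

theorem traceRate_of_ne (hind : IsHarmFamily r ind) {A : Finset V} {i j : V} (hj : j ∈ A)
    (hij : i ≠ j) : traceRate r ind A i j = ∑ k, r i k * ind A j k := by
  rw [traceRate, if_neg hij, ← Finset.sum_add_sum_compl A]
  congr 1
  rw [Finset.sum_congr rfl fun k hk => by rw [hind.apply_of_mem hj hk]]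
  simp [hj]

theorem lamA_eq_sum (hind : IsHarmFamily r ind) (hr_nonneg : ∀ i j, 0 ≤ r i j)
    (hr_irr : IrreducibleRates r) {A : Finset V} {i : V} (hi : i ∈ A) :
    lamA r ind A i = ∑ k, lamV r k * ind A i k := by
  have hrow : ∑ j ∈ A, ∑ k, r i k * ind A j k = ∑ k, r i k := by
    rw [Finset.sum_comm]
    refine Finset.sum_congr rfl fun k _ => ?_
    rw [← Finset.mul_sum, hind.sum_eq_one hr_nonneg hr_irr ⟨i, hi⟩, mul_one]
  have hgen : ∀ j ∈ A, generator r (ind A i) j =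
      (∑ k, r j k * ind A i k) - if j = i then ∑ k, r i k else 0 := by
    intro j hj
    rw [generator_apply]
    simp only [mul_sub, Finset.sum_sub_distrib, hind.apply_of_mem hi hj]
    split_ifs with h <;> simp [h]
  rw [← sum_generator, ← Finset.sum_add_sum_compl A (generator r (ind A i)),
    Finset.sum_eq_zero (s := Aᶜ) fun k hk =>
      hind.generator_eq_zero hi (Finset.mem_compl.mp hk),
    add_zero, Finset.sum_congr rfl hgen, Finset.sum_sub_distrib, Finset.sum_ite_eq', if_pos hi,
    ← hrow, ← Finset.sum_sub_distrib, lamA]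
  refine Finset.sum_congr rfl fun j hj => ?_
  rcases eq_or_ne j i with rfl | hji
  · simp
  · rw [hind.traceRate_of_ne hi hji, hind.traceRate_of_ne hj hji.symm]

theorem lamA_eq_add_insert (hind : IsHarmFamily r ind) (hr_nonneg : ∀ i j, 0 ≤ r i j)
    (hr_irr : IrreducibleRates r) {A : Finset V} {i b : V} (hi : i ∈ A) (hb : b ∉ A) :
    lamA r ind A i = lamA r ind (insert b A) i + ind A i b * lamA r ind (insert b A) b := by
  rw [hind.lamA_eq_sum hr_nonneg hr_irr hi,
    hind.lamA_eq_sum hr_nonneg hr_irr (Finset.mem_insert_of_mem hi),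
    hind.lamA_eq_sum hr_nonneg hr_irr (Finset.mem_insert_self b A), Finset.mul_sum,
    ← Finset.sum_add_distrib]
  refine Finset.sum_congr rfl fun k _ => ?_
  have hk := congrFun (hind.eq_add_smul_insert hr_nonneg hr_irr hi hb) k
  rw [Pi.add_apply, Pi.smul_apply, smul_eq_mul] at hk
  rw [hk]
  ring

/-- Removing from an absorbing set a point at which `λ^A` is nonpositive leaves it absorbing. -/
theorem isAbsorbing_erase (hind : IsHarmFamily r ind) (hr_nonneg : ∀ i j, 0 ≤ r i j)
    (hr_irr : IrreducibleRates r) {A : Finset V} (hA : IsAbsorbing r ind A) {i : V} (hi : i ∈ A)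
    (hlam : lamA r ind A i ≤ 0) : IsAbsorbing r ind (A.erase i) := by
  refine Or.inr fun j hj => ?_
  rcases eq_or_ne j i with rfl | hji
  · rwa [Finset.insert_erase hi]
  have hjA : j ∉ A := fun h => hj (Finset.mem_erase.mpr ⟨hji, h⟩)
  have hBj : lamA r ind (insert j A) j ≤ 0 := by
    rcases hA with rfl | h
    · exact absurd (Finset.mem_univ j) hjA
    · exact h j hjA
  have hiC : i ∉ insert j (A.erase i) := by simp [hji.symm]
  have hjC : j ∈ insert j (A.erase i) := Finset.mem_insert_self _ _
  have hB : insert i (insert j (A.erase i)) = insert j A := by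
    rw [Finset.insert_comm, Finset.insert_erase hi]
  have h₁ := hind.lamA_eq_add_insert hr_nonneg hr_irr hjC hiC
  have h₂ := hind.lamA_eq_add_insert hr_nonneg hr_irr hi hjA
  rw [hB] at h₁
  set p := ind (insert j (A.erase i)) j i
  set q := ind A i j
  have hp₀ : 0 ≤ p := hind.nonneg hr_nonneg hr_irr hjC i
  have hp₁ : p ≤ 1 := hind.le_one hr_nonneg hr_irr hjC i
  have hq₀ : 0 ≤ q := hind.nonneg hr_nonneg hr_irr hi j
  have hq₁ : q ≤ 1 := hind.le_one hr_nonneg hr_irr hi j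
  have hpq : p * q ≤ 1 := mul_le_one₀ hp₁ hq₀ hq₁
  have hdecomp : lamA r ind (insert j (A.erase i)) j =
      (1 - p * q) * lamA r ind (insert j A) j + p * lamA r ind A i := by
    rw [h₁, h₂]
    ring
  rw [hdecomp]
  exact add_nonpos (mul_nonpos_of_nonneg_of_nonpos (by linarith) hBj)
    (mul_nonpos_of_nonneg_of_nonpos hp₀ hlam)

end IsHarmFamily

/-- for every `S ⊆ V` there is an `r`-absorbing `A` with `S ⊆ A` and
`λ^A(i) > 0` for every `i ∈ A∖S`. -/
theorem exists_absorbing_superset (V : Type*) [Fintype V] [DecidableEq V] [Nonempty V]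
    (r : V → V → ℝ) (hr_nonneg : ∀ i j, 0 ≤ r i j) (hr_diag : ∀ i, r i i = 0)
    (hr_irr : IrreducibleRates r)
    (ind : Finset V → V → V → ℝ) (hind : IsHarmFamily r ind)
    (S : Finset V) :
    ∃ A : Finset V, IsAbsorbing r ind A ∧ S ⊆ A ∧ ∀ i ∈ A \ S, 0 < lamA r ind A i := by
  classical
  obtain ⟨A, hA, hmin⟩ := Finset.exists_min_image
    (Finset.univ.filter fun A : Finset V => IsAbsorbing r ind A ∧ S ⊆ A) Finset.card
    ⟨Finset.univ, Finset.mem_filter.mpr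
      ⟨Finset.mem_univ _, Or.inl rfl, Finset.subset_univ S⟩⟩
  obtain ⟨-, hAabs, hSA⟩ := Finset.mem_filter.mp hA
  refine ⟨A, hAabs, hSA, fun i hi => ?_⟩
  obtain ⟨hiA, hiS⟩ := Finset.mem_sdiff.mp hi
  by_contra! hlam
  refine (Finset.card_erase_lt_of_mem hiA).not_ge (hmin _ (Finset.mem_filter.mpr
    ⟨Finset.mem_univ _, hind.isAbsorbing_erase hr_nonneg hr_irr hAabs hiA hlam, ?_⟩))
  exact fun x hx => Finset.mem_erase.mpr ⟨fun h => hiS (h ▸ hx), hSA hx⟩
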